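/- Let X₁, X₂, Y₁, Y₂ be finite posets and let u₁ : X₁ → Y₁ and u₂ : X₂ → Y₂ be p-morphisms. Define u₁ ⊙ u₂ : X₁ ⊙ X₂ → Y₁ ⊙ Y₂ by (u₁ ⊙ u₂)(x, y) = (u₁(x), ⊥) if y = ⊥, (u₁ ⊙ u₂)(x, y) = (⊥, u₂(y)) if x = ⊥, and (u₁ ⊙ u₂)(x, y) = (u₁(x), u₂(y)) otherwise. Then u₁ ⊙ u₂ is a p-morphism and satisfies (u₁ ⊙ u₂) ∘ ι_{X₁} = ι_{Y₁} ∘ u₁ and (u₁ ⊙ u₂) ∘ ι_{X₂} = ι_{Y₂} ∘ u₂, where ι_X(x) = (x, ⊥) and ι_Y(y) = (⊥, y) are the canonical embeddings into the ⊙-product. -/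

import Mathlib

/-- The set of minimal elements of a poset `X` lying below `x`. -/
def minBelow (X : Type*) [PartialOrder X] (x : X) : Set X :=
  {m | m ≤ x ∧ ∀ z : X, z ≤ m → z = m}

/-- A p-morphism between posets: a monotone map commuting with `minBelow`. -/
def IsPMorphism {X Y : Type*} [PartialOrder X] [PartialOrder Y] (u : X → Y) : Prop :=
  Monotone u ∧ ∀ x : X, u '' minBelow X x = minBelow Y (u x)

/-- Condition `(*)`. -/
def StarCond (X : Type*) [PartialOrder X] : Prop :=
  ∀ x y : X, ∃ z : X, IsLUB {x, y} z ∧ minBelow X z = minBelow X x ∪ minBelow X y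

/-- Condition `(*_n)` for `n ≥ 1`. -/
def StarCondN (n : ℕ) (X : Type*) [PartialOrder X] : Prop :=
  ∀ x y : X, (minBelow X x ∪ minBelow X y).ncard ≤ n →
    ∃ z : X, IsLUB {x, y} z ∧ minBelow X z = minBelow X x ∪ minBelow X y

/-- Condition `(*_n)` with the convention that `(*_0)` means nonempty. -/
def StarCondN' (n : ℕ) (X : Type*) [PartialOrder X] : Prop :=
  if n = 0 then Nonempty X else StarCondN n X

/-- The poset `X` belongs to the class `P^f_n`. -/
def InPfn (n : ℕ) (X : Type*) [PartialOrder X] : Prop :=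
  ∀ x : X, (minBelow X x).ncard ≤ n

/-- `M` is a complete set for the preordered class `(S, le)`. -/
def IsCompleteSet {S : Type*} (le : S → S → Prop) (M : Set S) : Prop :=
  ∀ x : S, ∃ y ∈ M, le x y

/-- `M` is a minimal complete set for the preordered class `(S, le)`. -/
def IsMinimalCompleteSet {S : Type*} (le : S → S → Prop) (M : Set S) : Prop :=
  IsCompleteSet le M ∧ ∀ x ∈ M, ∀ y ∈ M, le x y → x = y

/-- A connected subset of a poset. -/
def IsConnectedSub (X : Type*) [PartialOrder X] (Y : Set X) : Prop :=
  (∀ y ∈ Y, minBelow X y ⊆ Y) ∧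
  ∀ x ∈ Y, ∀ y ∈ Y, ∃ z ∈ Y, x ≤ z ∧ y ≤ z ∧
    minBelow X z = minBelow X x ∪ minBelow X y

/-- An `n`-connected subset of a poset. -/
def IsNConnectedSub (n : ℕ) (X : Type*) [PartialOrder X] (Y : Set X) : Prop :=
  (∀ y ∈ Y, minBelow X y ⊆ Y) ∧
  (∀ S : Set X, S ⊆ (⋃ y ∈ Y, minBelow X y) → S.Nonempty → S.ncard ≤ n →
    ∃ z ∈ Y, minBelow X z = S) ∧
  (∀ x ∈ Y, ∀ y ∈ Y, minBelow X x = minBelow X y → (minBelow X x).ncard < n →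
    ∃ (r : ℕ) (c : ℕ → X), c 0 = x ∧ c r = y ∧ (∀ i ≤ r, c i ∈ Y) ∧
      (∀ i ≤ r, minBelow X (c i) = minBelow X x) ∧
      (∀ i < r, if Even i then c (i + 1) ≤ c i else c i ≤ c (i + 1)))

/-- The special product `X ⊙ Y`. -/
abbrev Odot (X Y : Type*) : Type _ :=
  {p : WithBot X × WithBot Y // p ≠ (⊥, ⊥)}

/-- The subposet `(X)_n` of elements with at most `n` minimal elements below them. -/
abbrev SubPn (n : ℕ) (X : Type*) [PartialOrder X] : Type _ :=
  {x : X // (minBelow X x).ncard ≤ n}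

/-- A unifier for a finite poset `X`: a p-morphism into `X` from a nonempty finite
poset satisfying `(*)`. -/
structure Unifier (X : Type) [PartialOrder X] [Finite X] : Type 1 where
  Y : Type
  [po : PartialOrder Y]
  [fin : Finite Y]
  ne : Nonempty Y
  star : StarCond Y
  u : Y → X
  hu : IsPMorphism u

attribute [instance] Unifier.po Unifier.fin

/-- The "more general" preorder on unifiers: `v ≼ w`. -/
def UnifierLE {X : Type} [PartialOrder X] [Finite X] (v w : Unifier X) : Prop :=
  ∃ ψ : v.Y → w.Y, IsPMorphism ψ ∧ w.u ∘ ψ = v.u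

/-- An `n`-unifier for a finite poset `X` in `P^f_n`. -/
structure UnifierN (n : ℕ) (X : Type) [PartialOrder X] [Finite X] : Type 1 where
  Y : Type
  [po : PartialOrder Y]
  [fin : Finite Y]
  ne : Nonempty Y
  mem : InPfn n Y
  star : StarCondN n Y
  u : Y → X
  hu : IsPMorphism u

attribute [instance] UnifierN.po UnifierN.fin

/-- The "more general" preorder on `n`-unifiers: `v ≼ w`. -/
def UnifierNLE {n : ℕ} {X : Type} [PartialOrder X] [Finite X] (v w : UnifierN n X) : Prop :=
  ∃ ψ : v.Y → w.Y, IsPMorphism ψ ∧ w.u ∘ ψ = v.u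

/-- The canonical left embedding `X → X ⊙ Y`. -/
def iotaL {X Y : Type*} (x : X) : Odot X Y :=
  ⟨((x : WithBot X), ⊥), by simp [Prod.ext_iff]⟩

/-- The canonical right embedding `Y → X ⊙ Y`. -/
def iotaR {X Y : Type*} (y : Y) : Odot X Y :=
  ⟨(⊥, (y : WithBot Y)), by simp [Prod.ext_iff]⟩

/-- The map `u₁ ⊙ u₂ : X₁ ⊙ X₂ → Y₁ ⊙ Y₂`; it sends `(x, ⊥)` to `(u₁ x, ⊥)`,
`(⊥, y)` to `(⊥, u₂ y)` and `(x, y)` to `(u₁ x, u₂ y)`. -/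
def odotMap {X₁ X₂ Y₁ Y₂ : Type*} (u₁ : X₁ → Y₁) (u₂ : X₂ → Y₂) (p : Odot X₁ X₂) :
    Odot Y₁ Y₂ :=
  ⟨(WithBot.map u₁ p.1.1, WithBot.map u₂ p.1.2), by
    have hp := p.2
    simp only [ne_eq, Prod.ext_iff, WithBot.map_eq_bot_iff] at hp ⊢
    tauto⟩

/-- Every element below `iotaL m` is of the form `iotaL z` with `z ≤ m`. -/
theorem exists_eq_iotaL_of_le {X Y : Type*} [PartialOrder X] [PartialOrder Y] {m : X}
    {r : Odot X Y} (h : r ≤ iotaL m) : ∃ z ≤ m, r = iotaL z := by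
  obtain ⟨⟨a, b⟩, hr⟩ := r
  obtain ⟨ha, hb⟩ : a ≤ (m : WithBot X) ∧ b ≤ ⊥ := h
  obtain rfl := le_bot_iff.1 hb
  cases a with
  | bot => exact absurd rfl hr
  | coe z => exact ⟨z, WithBot.coe_le_coe.1 ha, rfl⟩

/-- Every element below `iotaR m` is of the form `iotaR z` with `z ≤ m`. -/
theorem exists_eq_iotaR_of_le {X Y : Type*} [PartialOrder X] [PartialOrder Y] {m : Y}
    {r : Odot X Y} (h : r ≤ iotaR m) : ∃ z ≤ m, r = iotaR z := by
  obtain ⟨⟨a, b⟩, hr⟩ := r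
  obtain ⟨ha, hb⟩ : a ≤ ⊥ ∧ b ≤ (m : WithBot Y) := h
  obtain rfl := le_bot_iff.1 ha
  cases b with
  | bot => exact absurd rfl hr
  | coe z => exact ⟨z, WithBot.coe_le_coe.1 hb, rfl⟩

/-- The minimal elements of `X ⊙ Y` below `p` are the images under the canonical embeddings
of the minimal elements below the components of `p`. -/
theorem mem_minBelow_odot_iff {X Y : Type*} [PartialOrder X] [PartialOrder Y]
    {p q : Odot X Y} :
    q ∈ minBelow (Odot X Y) p ↔
      (∃ x : X, p.1.1 = x ∧ ∃ m ∈ minBelow X x, iotaL m = q) ∨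
        ∃ y : Y, p.1.2 = y ∧ ∃ m ∈ minBelow Y y, iotaR m = q := by
  constructor
  · rintro ⟨hle, hmin⟩
    obtain ⟨⟨a, b⟩, hq⟩ := q
    obtain ⟨ha, hb⟩ : a ≤ p.1.1 ∧ b ≤ p.1.2 := hle
    cases a with
    | bot =>
      cases b with
      | bot => exact absurd rfl hq
      | coe m =>
        obtain ⟨y, hy, hmy⟩ := WithBot.coe_le_iff.1 hb
        refine Or.inr ⟨y, hy, m, ⟨hmy, fun z hz => ?_⟩, rfl⟩
        have h := hmin (iotaR z) ⟨le_rfl, WithBot.coe_le_coe.2 hz⟩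
        exact WithBot.coe_injective (congrArg (fun r => r.1.2) h)
    | coe m =>
      obtain ⟨x, hx, hmx⟩ := WithBot.coe_le_iff.1 ha
      have hb' : ⊥ = b := congrArg (fun r => r.1.2) (hmin (iotaL m) ⟨le_rfl, bot_le⟩)
      subst hb'
      refine Or.inl ⟨x, hx, m, ⟨hmx, fun z hz => ?_⟩, rfl⟩
      have h := hmin (iotaL z) ⟨WithBot.coe_le_coe.2 hz, le_rfl⟩
      exact WithBot.coe_injective (congrArg (fun r => r.1.1) h)
  · rintro (⟨x, hx, m, ⟨hmx, hmin⟩, rfl⟩ | ⟨y, hy, m, ⟨hmy, hmin⟩, rfl⟩)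
    · refine ⟨⟨hx ▸ WithBot.coe_le_coe.2 hmx, bot_le⟩, fun r hr => ?_⟩
      obtain ⟨z, hz, rfl⟩ := exists_eq_iotaL_of_le hr
      rw [hmin z hz]
    · refine ⟨⟨bot_le, hy ▸ WithBot.coe_le_coe.2 hmy⟩, fun r hr => ?_⟩
      obtain ⟨z, hz, rfl⟩ := exists_eq_iotaR_of_le hr
      rw [hmin z hz]

/-- `u₁ ⊙ u₂` is a p-morphism making the two squares with the canonical
embeddings commute. -/
theorem odotMap_isPMorphism_and_commutes {X₁ X₂ Y₁ Y₂ : Type*}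
    [PartialOrder X₁] [PartialOrder X₂] [PartialOrder Y₁] [PartialOrder Y₂]
    [Finite X₁] [Finite X₂] [Finite Y₁] [Finite Y₂]
    (u₁ : X₁ → Y₁) (u₂ : X₂ → Y₂)
    (hu₁ : IsPMorphism u₁) (hu₂ : IsPMorphism u₂) :
    IsPMorphism (odotMap u₁ u₂) ∧
      (∀ x : X₁, odotMap u₁ u₂ (iotaL (Y := X₂) x) = iotaL (Y := Y₂) (u₁ x)) ∧
      (∀ y : X₂, odotMap u₁ u₂ (iotaR (X := X₁) y) = iotaR (X := Y₁) (u₂ y)) := by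
  refine ⟨⟨fun p q h => ⟨hu₁.1.withBot_map h.1, hu₂.1.withBot_map h.2⟩, fun p => ?_⟩,
    fun _ => rfl, fun _ => rfl⟩
  ext q
  rw [mem_minBelow_odot_iff]
  constructor
  · rintro ⟨r, hr, rfl⟩
    obtain ⟨x, hx, m, hm, rfl⟩ | ⟨y, hy, m, hm, rfl⟩ := mem_minBelow_odot_iff.1 hr
    · exact Or.inl ⟨u₁ x, congrArg (WithBot.map u₁) hx, u₁ m, hu₁.2 x ▸ ⟨m, hm, rfl⟩, rfl⟩
    · exact Or.inr ⟨u₂ y, congrArg (WithBot.map u₂) hy, u₂ m, hu₂.2 y ▸ ⟨m, hm, rfl⟩, rfl⟩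
  · rintro (⟨x', hx', m', hm', rfl⟩ | ⟨y', hy', m', hm', rfl⟩)
    · obtain ⟨x, hx, rfl⟩ := WithBot.map_eq_some_iff.1 hx'
      rw [← hu₁.2 x] at hm'
      obtain ⟨m, hm, rfl⟩ := hm'
      exact ⟨iotaL m, mem_minBelow_odot_iff.2 (Or.inl ⟨x, hx, m, hm, rfl⟩), rfl⟩
    · obtain ⟨y, hy, rfl⟩ := WithBot.map_eq_some_iff.1 hy'
      rw [← hu₂.2 y] at hm'
      obtain ⟨m, hm, rfl⟩ := hm'
      exact ⟨iotaR m, mem_minBelow_odot_iff.2 (Or.inr ⟨y, hy, m, hm, rfl⟩), rfl⟩
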